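/- arXiv:math-ph/0603010 — 4 statements merged into one kernel-verified Lean document; each statement's English description precedes it below -/
import Mathlib

section
/- Let 𝔖 be a unitary n × n matrix on ℂⁿ = ℂ^E ⊕ ℂ^I ⊕ ℂ^I, let k ∈ ℝ \ {0} and a ∈ ℝ^I, and set K := I − 𝔖 T(k; a). Then the range of the map 𝔖 ∘ ι_E : ℂ^E → ℂⁿ is contained in the range of K. (In particular, the equation K x = 𝔖 ι_E χ is solvable for every χ ∈ ℂ^E, even when det K = 0.) -/
noncomputable section

/-- The block matrix `T(t)` on `ℂ^E ⊕ ℂ^I ⊕ ℂ^I`, whose only nonzero blocks are the two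
off-diagonal `ℂ^I × ℂ^I` blocks, both equal to `diag(t)`. -/
def Tmat (E : Type*) {I : Type*} [DecidableEq I] (t : I → ℂ) :
    Matrix (E ⊕ I ⊕ I) (E ⊕ I ⊕ I) ℂ :=
  Matrix.of fun p q =>
    match p, q with
    | Sum.inr (Sum.inl i), Sum.inr (Sum.inr j) => if i = j then t i else 0
    | Sum.inr (Sum.inr i), Sum.inr (Sum.inl j) => if i = j then t i else 0
    | _, _ => 0

/-- `T(k; a) := T(t)` with `t_j = e^{i k a_j}`. -/
def TmatK (E : Type*) {I : Type*} [DecidableEq I] (k : ℝ) (a : I → ℝ) :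
    Matrix (E ⊕ I ⊕ I) (E ⊕ I ⊕ I) ℂ :=
  Tmat E fun j => Complex.exp (Complex.I * k * a j)

/-- Fredholm alternative: `b` is in the range of `A` if every left null vector of `A`
annihilates `b`. -/
theorem exists_mulVec_eq_of_forall_vecMul_eq_zero {K m n : Type*} [Field K] [Fintype m]
    [Fintype n] [DecidableEq m] (A : Matrix m n K) (b : m → K)
    (h : ∀ v : m → K, Matrix.vecMul v A = 0 → v ⬝ᵥ b = 0) : ∃ x, A.mulVec x = b := by
  by_contra hb
  obtain ⟨f, hfb, hf⟩ :=
    Submodule.exists_le_ker_of_notMem (p := LinearMap.range A.mulVecLin) (v := b)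
      (fun hmem => hb (by simpa using hmem))
  obtain ⟨v, rfl⟩ := (dotProductEquiv K m).surjective f
  refine hfb (h v (dotProduct_eq_zero _ fun x => ?_))
  rw [← Matrix.dotProduct_mulVec]
  exact hf ⟨x, rfl⟩

/-- A unitary matrix preserves the sum of squared moduli under right multiplication. -/
theorem sum_normSq_vecMul_of_mem_unitaryGroup {n : Type*} [Fintype n] [DecidableEq n]
    {S : Matrix n n ℂ} (hS : S ∈ Matrix.unitaryGroup n ℂ) (v : n → ℂ) :
    ∑ p, Complex.normSq (Matrix.vecMul v S p) = ∑ p, Complex.normSq (v p) := by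
  have h : Matrix.vecMul v S ⬝ᵥ star (Matrix.vecMul v S) = v ⬝ᵥ star v := by
    rw [Matrix.star_vecMul, ← Matrix.dotProduct_mulVec, Matrix.mulVec_mulVec,
      ← Matrix.star_eq_conjTranspose, Matrix.mem_unitaryGroup_iff.mp hS, Matrix.one_mulVec]
  have key (u : n → ℂ) : u ⬝ᵥ star u = ((∑ p, Complex.normSq (u p) : ℝ) : ℂ) := by
    simp [dotProduct, Complex.mul_conj]
  rw [key, key] at h
  exact_mod_cast h

/-- If all `t i` have modulus one, then right multiplication by `T(t)` discards exactly the
`ℂ^E` component. -/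
theorem sum_normSq_vecMul_Tmat {E I : Type*} [Fintype E] [Fintype I] [DecidableEq I]
    {t : I → ℂ} (ht : ∀ i, Complex.normSq (t i) = 1) (w : E ⊕ I ⊕ I → ℂ) :
    ∑ p, Complex.normSq (Matrix.vecMul w (Tmat E t) p) + ∑ e, Complex.normSq (w (Sum.inl e)) =
      ∑ p, Complex.normSq (w p) := by
  simp [Fintype.sum_sum_type, Matrix.vecMul, dotProduct, Tmat, ht]
  ring

theorem stmt8 {E I : Type*} [Fintype E] [Fintype I] [DecidableEq E] [DecidableEq I]
    (S : Matrix (E ⊕ I ⊕ I) (E ⊕ I ⊕ I) ℂ)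
    (hS : S ∈ Matrix.unitaryGroup (E ⊕ I ⊕ I) ℂ)
    (k : ℝ) (hk : k ≠ 0) (a : I → ℝ) :
    ∀ χ : E → ℂ, ∃ x : E ⊕ I ⊕ I → ℂ,
      (1 - S * TmatK E k a).mulVec x = S.mulVec (Sum.elim χ 0) := by
  intro χ
  refine exists_mulVec_eq_of_forall_vecMul_eq_zero _ _ fun v hv => ?_
  have ht (i : I) : Complex.normSq (Complex.exp (Complex.I * k * a i)) = 1 := by
    simp [Complex.normSq_eq_norm_sq, Complex.norm_exp]
  have hv' : Matrix.vecMul (Matrix.vecMul v S) (TmatK E k a) = v := by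
    rw [Matrix.vecMul_sub, Matrix.vecMul_one, sub_eq_zero] at hv
    rw [Matrix.vecMul_vecMul, ← hv]
  have hsum := sum_normSq_vecMul_Tmat ht (Matrix.vecMul v S)
  change ∑ p, Complex.normSq (Matrix.vecMul (Matrix.vecMul v S) (TmatK E k a) p) + _ = _ at hsum
  rw [hv', sum_normSq_vecMul_of_mem_unitaryGroup hS, add_eq_left,
    Finset.sum_eq_zero_iff_of_nonneg fun _ _ => Complex.normSq_nonneg _] at hsum
  have hw (e : E) : Matrix.vecMul v S (Sum.inl e) = 0 :=
    Complex.normSq_eq_zero.mp (hsum e (Finset.mem_univ e))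
  rw [Matrix.dotProduct_mulVec]
  simp [dotProduct, hw]
end
end

section
/- Let 𝔖 be a unitary n × n matrix on ℂⁿ = ℂ^E ⊕ ℂ^I ⊕ ℂ^I, let k ∈ ℝ \ {0} and a ∈ ℝ^I, and assume that I − 𝔖 T(k; a) is invertible. Then the |E| × |E| matrix S := P_E (I − 𝔖 T(k; a))⁻¹ 𝔖 ι_E is unitary. -/
noncomputable section

open scoped Matrix in
/-- If `Tᴴ * T` is the projection complementary to the first summand and `T` has vanishing rows
there, then compressing a solution `M` of `M = S * (1 + T * M)`, `S` unitary, to the first summand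
gives an isometry. -/
lemma conjTranspose_mul_self_toBlocks₁₁_eq_one {m n : Type*} [Fintype m] [Fintype n]
    [DecidableEq m] [DecidableEq n] {S T M : Matrix (m ⊕ n) (m ⊕ n) ℂ}
    (hS : Sᴴ * S = 1) (hT : Tᴴ * T + Matrix.fromBlocks 1 0 0 0 = 1)
    (hT₀ : ∀ i q, T (Sum.inl i) q = 0) (hM : M = S * (1 + T * M)) :
    M.toBlocks₁₁ᴴ * M.toBlocks₁₁ = 1 := by
  have hMM : Mᴴ * M = 1 + T * M + (T * M)ᴴ + Mᴴ * (Tᴴ * T) * M := by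
    calc Mᴴ * M = (S * (1 + T * M))ᴴ * (S * (1 + T * M)) := by rw [← hM]
      _ = (1 + T * M)ᴴ * (Sᴴ * S) * (1 + T * M) := by
        simp only [Matrix.conjTranspose_mul, Matrix.mul_assoc]
      _ = _ := by
        rw [hS]
        simp only [Matrix.conjTranspose_add, Matrix.conjTranspose_one, Matrix.conjTranspose_mul]
        noncomm_ring
  have hP : Mᴴ * Matrix.fromBlocks 1 0 0 0 * M = 1 + T * M + (T * M)ᴴ := by
    rw [eq_sub_iff_add_eq'.mpr hT, mul_sub, sub_mul, mul_one, hMM]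
    abel
  have hblock : (Mᴴ * Matrix.fromBlocks 1 0 0 0 * M).toBlocks₁₁ =
      M.toBlocks₁₁ᴴ * M.toBlocks₁₁ := by
    obtain ⟨A, B, C, D, rfl⟩ : ∃ A B C D, M = Matrix.fromBlocks A B C D :=
      ⟨_, _, _, _, M.fromBlocks_toBlocks.symm⟩
    simp [Matrix.fromBlocks_conjTranspose, Matrix.fromBlocks_multiply]
  have hTM : ∀ i q, (T * M) (Sum.inl i) q = 0 := fun i q => by
    simp [Matrix.mul_apply, hT₀]
  rw [← hblock, hP]
  ext i j
  simp [Matrix.toBlocks₁₁, Matrix.one_apply, hTM, -Matrix.conjTranspose_mul]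

open scoped Matrix in
/-- For unimodular entries, `T(t)ᴴ T(t)` is the projection onto the last two summands. -/
lemma Tmat_conjTranspose_mul_self_add (E : Type*) {I : Type*} [Fintype E] [Fintype I]
    [DecidableEq E] [DecidableEq I] {t : I → ℂ} (ht : ∀ i, star (t i) * t i = 1) :
    (Tmat E t)ᴴ * Tmat E t + Matrix.fromBlocks 1 0 0 0 = 1 := by
  ext p q
  rcases p with p | p | p <;> rcases q with q | q | q <;>
    simp [Matrix.mul_apply, Tmat, Matrix.one_apply]
  all_goals
    rcases eq_or_ne p q with rfl | h
    · simpa using ht p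
    · simp [h, h.symm]

theorem stmt9 {E I : Type*} [Fintype E] [Fintype I] [DecidableEq E] [DecidableEq I]
    (S : Matrix (E ⊕ I ⊕ I) (E ⊕ I ⊕ I) ℂ)
    (hS : S ∈ Matrix.unitaryGroup (E ⊕ I ⊕ I) ℂ)
    (k : ℝ) (hk : k ≠ 0) (a : I → ℝ)
    (hK : IsUnit (1 - S * TmatK E k a)) :
    ((1 - S * TmatK E k a)⁻¹ * S).submatrix Sum.inl Sum.inl ∈
      Matrix.unitaryGroup E ℂ := by
  rw [Matrix.mem_unitaryGroup_iff']
  refine conjTranspose_mul_self_toBlocks₁₁_eq_one (S := S) (T := TmatK E k a)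
    (M := (1 - S * TmatK E k a)⁻¹ * S) (Matrix.mem_unitaryGroup_iff'.mp hS)
    (Tmat_conjTranspose_mul_self_add E fun i => ?_) (fun _ _ => rfl) ?_
  · rw [Complex.star_def, ← Complex.normSq_eq_conj_mul_self, Complex.normSq_eq_norm_sq,
      show Complex.I * k * a i = ((k * a i : ℝ) : ℂ) * Complex.I by push_cast; ring,
      Complex.norm_exp_ofReal_mul_I]
    simp
  · have h : (1 - S * TmatK E k a) * ((1 - S * TmatK E k a)⁻¹ * S) = S :=
      Matrix.mul_nonsing_inv_cancel_left _ _ ((Matrix.isUnit_iff_isUnit_det _).mp hK)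
    rw [sub_mul, one_mul, sub_eq_iff_eq_add] at h
    rw [mul_add, mul_one, ← mul_assoc S (TmatK E k a)]
    exact h
end
end

section
/- For Haar-almost every U in the unitary group U(n) (n ≥ 1): the matrix U + I is invertible, the matrix H(U) := −2i (U − I)(U + I)⁻¹ is Hermitian, all entries of H(U) are nonzero, and all eigenvalues of H(U) are simple. -/
noncomputable section

open MeasureTheory

/-- Matrices over `ℂ` carry the Borel σ-algebra of their (product) topology. -/
instance matrixMeasurableSpace {m l : Type*} : MeasurableSpace (Matrix m l ℂ) :=
  borel _

instance matrixBorelSpace {m l : Type*} : BorelSpace (Matrix m l ℂ) := ⟨rfl⟩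

/-- The (inverse) Cayley transform `H(U) := −2i (U − I)(U + I)⁻¹` of a unitary matrix. -/
def HofU {n : ℕ} (U : Matrix.unitaryGroup (Fin n) ℂ) : Matrix (Fin n) (Fin n) ℂ :=
  (-2 * Complex.I) •
    (((U : Matrix (Fin n) (Fin n) ℂ) - 1) * ((U : Matrix (Fin n) (Fin n) ℂ) + 1)⁻¹)

open Matrix

/-! ### Null sets in real vector spaces -/

/-- A measurable set meeting almost no point of each line through `x₀` is null for every additive
Haar measure. -/
theorem addHaar_eq_zero_of_forall_line {E : Type*} [NormedAddCommGroup E] [NormedSpace ℝ E]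
    [FiniteDimensional ℝ E] [MeasurableSpace E] [BorelSpace E]
    (ν : Measure E) [ν.IsAddHaarMeasure] {Z : Set E} (hZ : MeasurableSet Z) (x₀ : E)
    (h : ∀ v : E, volume {t : ℝ | x₀ + t • v ∈ Z} = 0) : ν Z = 0 := by
  have : ProperSpace E := FiniteDimensional.proper ℝ E
  have hmeas : Measurable fun p : ℝ × E => x₀ + p.1 • p.2 := by
    apply Continuous.measurable
    fun_prop
  have hs : MeasurableSet ((fun p : ℝ × E => x₀ + p.1 • p.2) ⁻¹' Z) := hmeas hZ
  have h0 : (volume.prod ν) ((fun p : ℝ × E => x₀ + p.1 • p.2) ⁻¹' Z) = 0 := by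
    rw [Measure.prod_apply_symm hs]
    simp only [lintegral_eq_zero_iff' (measurable_measure_prodMk_right hs).aemeasurable]
    exact Filter.Eventually.of_forall h
  rw [Measure.measure_prod_null hs] at h0
  obtain ⟨t, ht, ht0⟩ := (h0.and (Measure.ae_ne volume (0 : ℝ))).exists
  have h1 : ν ((t • ·) ⁻¹' ((x₀ + ·) ⁻¹' Z)) = 0 := ht
  rw [Measure.addHaar_preimage_smul ν ht0, measure_preimage_add, mul_eq_zero] at h1
  refine h1.resolve_left ?_
  have : 0 < |(t ^ Module.finrank ℝ E)⁻¹| := abs_pos.mpr (inv_ne_zero (pow_ne_zero _ ht0))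
  simpa only [ne_eq, ENNReal.ofReal_eq_zero, not_le] using this

theorem volume_zeros_eq_zero_of_analyticAt {f : ℝ → ℂ} (hf : ∀ t, AnalyticAt ℝ f t) {t₀ : ℝ}
    (h : f t₀ ≠ 0) : volume {t | f t = 0} = 0 := by
  have h1 := AnalyticOnNhd.preimage_zero_mem_codiscrete (f := f) (fun t _ => hf t) h
  have h2 := ae_restrict_le_codiscreteWithin (μ := volume) MeasurableSet.univ h1
  rw [Measure.restrict_univ, mem_ae_iff] at h2
  convert h2 using 2
  ext t
  simp

/-! ### Analytic curves of matrices -/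

section Curves

variable {n : ℕ}

/-- A curve of complex matrices all of whose entries are real analytic. -/
def CurveAnalytic (γ : ℝ → Matrix (Fin n) (Fin n) ℂ) : Prop :=
  ∀ i j t, AnalyticAt ℝ (fun s => γ s i j) t

namespace CurveAnalytic

variable {γ δ : ℝ → Matrix (Fin n) (Fin n) ℂ}

theorem const (A : Matrix (Fin n) (Fin n) ℂ) : CurveAnalytic fun _ => A :=
  fun _ _ _ => analyticAt_const

theorem add (hγ : CurveAnalytic γ) (hδ : CurveAnalytic δ) : CurveAnalytic fun t => γ t + δ t :=
  fun i j t => (hγ i j t).add (hδ i j t)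

theorem sub (hγ : CurveAnalytic γ) (hδ : CurveAnalytic δ) : CurveAnalytic fun t => γ t - δ t :=
  fun i j t => (hγ i j t).sub (hδ i j t)

theorem smul {f : ℝ → ℂ} (hf : ∀ t, AnalyticAt ℝ f t) (hγ : CurveAnalytic γ) :
    CurveAnalytic fun t => f t • γ t :=
  fun i j t => (hf t).mul (hγ i j t)

theorem mul (hγ : CurveAnalytic γ) (hδ : CurveAnalytic δ) : CurveAnalytic fun t => γ t * δ t := by
  intro i j t
  simp only [Matrix.mul_apply]
  exact Finset.analyticAt_fun_sum _ fun k _ => (hγ i k t).mul (hδ k j t)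

theorem pow (hγ : CurveAnalytic γ) (k : ℕ) : CurveAnalytic fun t => γ t ^ k := by
  induction k with
  | zero => simpa using const 1
  | succ k ih => simpa only [pow_succ] using ih.mul hγ

theorem det (hγ : CurveAnalytic γ) (t : ℝ) : AnalyticAt ℝ (fun s => (γ s).det) t := by
  simp only [Matrix.det_apply']
  exact Finset.analyticAt_fun_sum _ fun σ _ => analyticAt_const.mul <|
    Finset.analyticAt_fun_prod _ fun i _ => hγ _ _ t

theorem adjugate (hγ : CurveAnalytic γ) : CurveAnalytic fun t => (γ t).adjugate := by
  intro i j t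
  simp only [Matrix.adjugate_apply]
  refine det (γ := fun s => (γ s).updateRow j (Pi.single i 1)) (fun k l t => ?_) t
  by_cases hk : k = j
  · subst hk
    simpa using analyticAt_const
  · simpa [Matrix.updateRow_ne hk] using hγ k l t

theorem inv (hγ : CurveAnalytic γ) (h : ∀ t, (γ t).det ≠ 0) : CurveAnalytic fun t => (γ t)⁻¹ := by
  simp only [Matrix.inv_def, Ring.inverse_eq_inv']
  exact smul (fun t => (hγ.det t).inv (h t)) hγ.adjugate

end CurveAnalytic

end Curves

/-! ### The Cayley transform -/

section Cayley

variable {n : ℕ}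

/-- The Cayley transform `X ↦ (1 + iX)(1 - iX)⁻¹`. -/
def cayley (X : Matrix (Fin n) (Fin n) ℂ) : Matrix (Fin n) (Fin n) ℂ :=
  (1 + Complex.I • X) * (1 - Complex.I • X)⁻¹

theorem one_sub_mul_one_add_I_smul (X : Matrix (Fin n) (Fin n) ℂ) :
    (1 - Complex.I • X) * (1 + Complex.I • X) = 1 + X * X := by
  simp only [sub_mul, mul_add, one_mul, mul_one, smul_mul_smul_comm, Complex.I_mul_I, neg_smul,
    one_smul]
  abel

theorem one_add_mul_one_sub_I_smul (X : Matrix (Fin n) (Fin n) ℂ) :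
    (1 + Complex.I • X) * (1 - Complex.I • X) = 1 + X * X := by
  simp only [add_mul, mul_sub, one_mul, mul_one, smul_mul_smul_comm, Complex.I_mul_I, neg_smul,
    one_smul]
  abel

open scoped ComplexOrder in
theorem Matrix.IsHermitian.isUnit_one_add_mul_self {X : Matrix (Fin n) (Fin n) ℂ}
    (hX : X.IsHermitian) : IsUnit (1 + X * X) := by
  have h := Matrix.posSemidef_conjTranspose_mul_self X
  rw [hX.eq] at h
  exact (Matrix.PosDef.one.add_posSemidef h).isUnit

theorem Matrix.IsHermitian.isUnit_det_one_sub {X : Matrix (Fin n) (Fin n) ℂ}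
    (hX : X.IsHermitian) : IsUnit (1 - Complex.I • X).det := by
  have h := hX.isUnit_one_add_mul_self
  rw [← one_sub_mul_one_add_I_smul, Matrix.isUnit_iff_isUnit_det, Matrix.det_mul] at h
  exact isUnit_of_mul_isUnit_left h

theorem Matrix.IsHermitian.isUnit_det_one_add {X : Matrix (Fin n) (Fin n) ℂ}
    (hX : X.IsHermitian) : IsUnit (1 + Complex.I • X).det := by
  have h := hX.isUnit_one_add_mul_self
  rw [← one_sub_mul_one_add_I_smul, Matrix.isUnit_iff_isUnit_det, Matrix.det_mul] at h
  exact isUnit_of_mul_isUnit_right h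

theorem cayley_mem_unitaryGroup {X : Matrix (Fin n) (Fin n) ℂ} (hX : X.IsHermitian) :
    cayley X ∈ Matrix.unitaryGroup (Fin n) ℂ := by
  rw [Matrix.mem_unitaryGroup_iff']
  have hs : star (cayley X) = (1 + Complex.I • X)⁻¹ * (1 - Complex.I • X) := by
    rw [cayley, Matrix.star_eq_conjTranspose, Matrix.conjTranspose_mul,
      Matrix.conjTranspose_nonsing_inv]
    simp [Matrix.conjTranspose_smul, hX.eq, sub_eq_add_neg]
  rw [hs, cayley, mul_assoc, ← mul_assoc (1 - _), one_sub_mul_one_add_I_smul,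
    ← one_add_mul_one_sub_I_smul, mul_assoc, Matrix.mul_nonsing_inv _ hX.isUnit_det_one_sub,
    mul_one, Matrix.nonsing_inv_mul _ hX.isUnit_det_one_add]

theorem cayley_add_one {X : Matrix (Fin n) (Fin n) ℂ} (hX : X.IsHermitian) :
    cayley X + 1 = (2 : ℂ) • (1 - Complex.I • X)⁻¹ := by
  calc cayley X + 1
      = cayley X + (1 - Complex.I • X) * (1 - Complex.I • X)⁻¹ := by
        rw [Matrix.mul_nonsing_inv _ hX.isUnit_det_one_sub]
    _ = (2 : ℂ) • (1 - Complex.I • X)⁻¹ := by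
        rw [cayley, ← add_mul, ← smul_one_mul (2 : ℂ) (1 - Complex.I • X)⁻¹, two_smul]
        congr 1
        abel

theorem cayley_sub_one {X : Matrix (Fin n) (Fin n) ℂ} (hX : X.IsHermitian) :
    cayley X - 1 = (2 * Complex.I) • (X * (1 - Complex.I • X)⁻¹) := by
  calc cayley X - 1
      = cayley X - (1 - Complex.I • X) * (1 - Complex.I • X)⁻¹ := by
        rw [Matrix.mul_nonsing_inv _ hX.isUnit_det_one_sub]
    _ = (2 * Complex.I) • (X * (1 - Complex.I • X)⁻¹) := by
        rw [cayley, ← sub_mul, ← smul_mul_assoc, mul_smul, two_smul]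
        congr 1
        abel

theorem cayley_sub_one_mul_inv {X : Matrix (Fin n) (Fin n) ℂ} (hX : X.IsHermitian) :
    (cayley X - 1) * (cayley X + 1)⁻¹ = Complex.I • X := by
  have h2 : (cayley X + 1)⁻¹ = (2 : ℂ)⁻¹ • (1 - Complex.I • X) := by
    apply Matrix.inv_eq_left_inv
    rw [cayley_add_one hX, smul_mul_smul_comm, Matrix.mul_nonsing_inv _ hX.isUnit_det_one_sub]
    norm_num
  rw [h2, cayley_sub_one hX, smul_mul_smul_comm, mul_assoc X,
    Matrix.nonsing_inv_mul _ hX.isUnit_det_one_sub, mul_one]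
  congr 1
  ring

theorem isUnit_cayley_add_one {X : Matrix (Fin n) (Fin n) ℂ} (hX : X.IsHermitian) :
    IsUnit (cayley X + 1) := by
  rw [cayley_add_one hX, Matrix.isUnit_iff_isUnit_det, Matrix.det_smul]
  exact IsUnit.mul (by simp) (Matrix.isUnit_nonsing_inv_det _ hX.isUnit_det_one_sub)

theorem isHermitian_HofU (U : Matrix.unitaryGroup (Fin n) ℂ)
    (h : IsUnit ((U : Matrix (Fin n) (Fin n) ℂ) + 1)) : (HofU U).IsHermitian := by
  obtain ⟨U, hU⟩ := U
  simp only [HofU, Matrix.IsHermitian] at h ⊢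
  rw [Matrix.isUnit_iff_isUnit_det] at h
  have h1 : Uᴴ * U = 1 := Matrix.mem_unitaryGroup_iff'.mp hU
  have h2 : U * Uᴴ = 1 := Matrix.mem_unitaryGroup_iff.mp hU
  have hdet : IsUnit (Uᴴ + 1).det := by
    have : (U + 1)ᴴ = Uᴴ + 1 := by simp
    rw [← this, Matrix.det_conjTranspose]
    exact h.star
  have key : (Uᴴ + 1)⁻¹ * (Uᴴ - 1) = -((U - 1) * (U + 1)⁻¹) := by
    have e : (Uᴴ - 1) * (U + 1) = -((Uᴴ + 1) * (U - 1)) := by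
      simp only [sub_mul, add_mul, mul_sub, mul_add, h1, one_mul, mul_one]
      abel
    calc (Uᴴ + 1)⁻¹ * (Uᴴ - 1) = (Uᴴ + 1)⁻¹ * ((Uᴴ - 1) * (U + 1)) * (U + 1)⁻¹ := by
          rw [mul_assoc, mul_assoc, Matrix.mul_nonsing_inv _ h, mul_one]
      _ = _ := by
          rw [e, mul_neg, ← mul_assoc, Matrix.nonsing_inv_mul _ hdet, one_mul, neg_mul]
  rw [Matrix.conjTranspose_smul, Matrix.conjTranspose_mul, Matrix.conjTranspose_nonsing_inv]
  simp only [Matrix.conjTranspose_add, Matrix.conjTranspose_sub, Matrix.conjTranspose_one, key]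
  simp

theorem cayley_half_HofU (U : Matrix.unitaryGroup (Fin n) ℂ)
    (h : IsUnit ((U : Matrix (Fin n) (Fin n) ℂ) + 1)) :
    cayley ((2⁻¹ : ℂ) • HofU U) = U := by
  rw [Matrix.isUnit_iff_isUnit_det] at h
  obtain ⟨U, hU⟩ := U
  simp only [HofU, cayley, smul_smul] at h ⊢
  have e : Complex.I * (2⁻¹ * (-2 * Complex.I)) = 1 := by
    linear_combination -Complex.I_mul_I
  rw [e, one_smul]
  have h1 : (1 : Matrix (Fin n) (Fin n) ℂ) = (U + 1) * (U + 1)⁻¹ :=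
    (Matrix.mul_nonsing_inv _ h).symm
  have ha : 1 + (U - 1) * (U + 1)⁻¹ = U * ((2 : ℂ) • (U + 1)⁻¹) := by
    nth_rewrite 1 [h1]
    rw [← add_mul, Matrix.mul_smul, ← smul_mul_assoc, two_smul]
    congr 1
    abel
  have hb : 1 - (U - 1) * (U + 1)⁻¹ = (2 : ℂ) • (U + 1)⁻¹ := by
    nth_rewrite 1 [h1]
    rw [← sub_mul, ← smul_one_mul (2 : ℂ) (U + 1)⁻¹, two_smul]
    congr 1
    abel
  have hdet : IsUnit ((2 : ℂ) • (U + 1)⁻¹).det := by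
    rw [Matrix.det_smul]
    refine IsUnit.mul (by simp) ?_
    exact Matrix.isUnit_nonsing_inv_det _ h
  rw [ha, hb, mul_assoc, Matrix.mul_nonsing_inv _ hdet, mul_one]

/-- The unitary matrix attached to a square array by the Cayley transform of `A + Aᴴ`. -/
def cayleyUnitary (A : Fin n → Fin n → ℂ) : Matrix.unitaryGroup (Fin n) ℂ :=
  ⟨cayley (Matrix.of A + (Matrix.of A)ᴴ),
    cayley_mem_unitaryGroup (Matrix.isHermitian_add_transpose_self _)⟩

theorem continuous_cayleyUnitary : Continuous (cayleyUnitary (n := n)) := by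
  refine Continuous.subtype_mk ?_ _
  have hX : Continuous fun A : Fin n → Fin n → ℂ => Matrix.of A + (Matrix.of A)ᴴ := by
    have : Continuous fun A : Fin n → Fin n → ℂ => Matrix.of A := continuous_id
    exact this.add this.matrix_conjTranspose
  have hI := hX.const_smul Complex.I
  unfold cayley
  refine (continuous_const.add hI).mul ?_
  simp only [Matrix.inv_def, Ring.inverse_eq_inv']
  refine Continuous.smul (Continuous.inv₀ (continuous_const.sub hI).matrix_det fun A => ?_)
    (continuous_const.sub hI).matrix_adjugate
  exact (Matrix.isHermitian_add_transpose_self _).isUnit_det_one_sub.ne_zero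

theorem curveAnalytic_cayleyUnitary_line (A v : Fin n → Fin n → ℂ) :
    CurveAnalytic fun t => (cayleyUnitary (A + t • v) : Matrix (Fin n) (Fin n) ℂ) := by
  have hX : CurveAnalytic fun t : ℝ => Matrix.of (A + t • v) + (Matrix.of (A + t • v))ᴴ := by
    intro i j t
    have hof : AnalyticAt ℝ (fun s : ℝ => (s : ℂ)) t := Complex.ofRealCLM.analyticAt t
    have : (fun s : ℝ => (Matrix.of (A + s • v) + (Matrix.of (A + s • v))ᴴ) i j) =
        fun s : ℝ => (A i j + s * v i j) + (star (A j i) + s * star (v j i)) := by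
      funext s
      simp
    rw [this]
    exact (analyticAt_const.add (hof.mul analyticAt_const)).add
      (analyticAt_const.add (hof.mul analyticAt_const))
  have hI := CurveAnalytic.smul (f := fun _ => Complex.I) (fun _ => analyticAt_const) hX
  exact ((CurveAnalytic.const 1).add hI).mul <| ((CurveAnalytic.const 1).sub hI).inv fun t =>
    (Matrix.isHermitian_add_transpose_self _).isUnit_det_one_sub.ne_zero

theorem exists_cayleyUnitary_eq (V : Matrix.unitaryGroup (Fin n) ℂ)
    (h : IsUnit ((V : Matrix (Fin n) (Fin n) ℂ) + 1)) : ∃ A, cayleyUnitary A = V := by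
  refine ⟨Matrix.of.symm ((4⁻¹ : ℂ) • HofU V), Subtype.ext ?_⟩
  have hH := isHermitian_HofU V h
  refine Eq.trans ?_ (cayley_half_HofU V h)
  simp only [cayleyUnitary, Equiv.apply_symm_apply, Matrix.conjTranspose_smul, hH.eq]
  congr 1
  rw [← add_smul]
  congr 1
  norm_num

end Cayley

/-! ### Null sets of the unitary group -/

section Unitary

variable {n : ℕ}

/-- The open condition `F ≠ 0` can be met, by rotating `W`, at a unitary matrix in the range of the
Cayley transform translated by `V`. -/
theorem exists_ne_zero_and_isUnit_mul_inv_add_one (V W : Matrix.unitaryGroup (Fin n) ℂ)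
    {F : Matrix (Fin n) (Fin n) ℂ → ℂ} (hF : Continuous F) (hW : F W ≠ 0) :
    ∃ W' : Matrix.unitaryGroup (Fin n) ℂ, F W' ≠ 0 ∧
      IsUnit (((W' * V⁻¹ : Matrix.unitaryGroup (Fin n) ℂ) : Matrix (Fin n) (Fin n) ℂ) + 1) := by
  set B : Matrix (Fin n) (Fin n) ℂ := 
    ((W * V⁻¹ : Matrix.unitaryGroup (Fin n) ℂ) : Matrix (Fin n) (Fin n) ℂ)
  let z : ℝ → ℂ := fun t => (1 + t * Complex.I) / (1 - t * Complex.I)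
  have hadd : ∀ t : ℝ, (1 + t * Complex.I : ℂ) ≠ 0 := fun t h => by
    simpa using congrArg Complex.re h
  have hsub : ∀ t : ℝ, (1 - t * Complex.I : ℂ) ≠ 0 := fun t h => by
    simpa using congrArg Complex.re h
  have hz : Continuous z :=
    Continuous.div (by fun_prop) (by fun_prop) hsub
  have hz0 : ∀ t, z t ≠ 0 := fun t => div_ne_zero (hadd t) (hsub t)
  have hzinj : Function.Injective fun t => (z t)⁻¹ := by
    intro s t hst
    have h := inv_injective hst
    simp only [z] at h
    rw [div_eq_div_iff (hsub s) (hsub t)] at h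
    have h2 : (s : ℂ) * (2 * Complex.I) = t * (2 * Complex.I) := by linear_combination h
    exact_mod_cast mul_right_cancel₀ (by simp) h2
  have hzstar : ∀ t, star (z t) * z t = 1 := by
    intro t
    simp only [z, star_div₀, star_add, star_sub, star_one, star_mul', Complex.star_def,
      Complex.conj_ofReal, Complex.conj_I]
    have h1 := hadd t
    have h2 := hsub t
    rw [mul_neg, sub_neg_eq_add, ← sub_eq_add_neg]
    field_simp
  have hopen : {t : ℝ | F (z t • (W : Matrix (Fin n) (Fin n) ℂ)) ≠ 0} ∈ nhds 0 := by
    refine (isOpen_ne_fun (hF.comp (hz.smul continuous_const)) continuous_const).mem_nhds ?_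
    simpa [z] using hW
  have hfin : ((fun t => (z t)⁻¹) ⁻¹' spectrum ℂ (-B)).Finite :=
    (Matrix.finite_spectrum (-B)).preimage hzinj.injOn
  obtain ⟨t, ht, hts⟩ := ((infinite_of_mem_nhds 0 hopen).sdiff hfin).nonempty
  have hmem : z t • (W : Matrix (Fin n) (Fin n) ℂ) ∈ Matrix.unitaryGroup (Fin n) ℂ := by
    rw [Matrix.mem_unitaryGroup_iff', star_smul, smul_mul_smul_comm, hzstar, one_smul]
    exact Matrix.mem_unitaryGroup_iff'.mp W.2
  refine ⟨⟨_, hmem⟩, ht, ?_⟩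
  have hunit : IsUnit ((z t)⁻¹ • (1 : Matrix (Fin n) (Fin n) ℂ) + B) := by
    simpa [spectrum.mem_iff, Algebra.algebraMap_eq_smul_one] using hts
  have heq : z t • (W : Matrix (Fin n) (Fin n) ℂ) * ((V⁻¹ : Matrix.unitaryGroup (Fin n) ℂ) :
      Matrix (Fin n) (Fin n) ℂ) + 1 = z t • ((z t)⁻¹ • (1 : Matrix (Fin n) (Fin n) ℂ) + B) := by
    rw [smul_add, smul_smul, mul_inv_cancel₀ (hz0 t), one_smul, add_comm, smul_mul_assoc]
    rfl
  change IsUnit (z t • (W : Matrix (Fin n) (Fin n) ℂ) * ((V⁻¹ : Matrix.unitaryGroup (Fin n) ℂ) :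
      Matrix (Fin n) (Fin n) ℂ) + 1)
  rw [heq, Matrix.isUnit_iff_isUnit_det, Matrix.det_smul]
  exact IsUnit.mul ((hz0 t).isUnit.pow _) ((Matrix.isUnit_iff_isUnit_det _).mp hunit)

theorem haar_zeros_eq_zero (μ : Measure (Matrix.unitaryGroup (Fin n) ℂ)) [μ.IsHaarMeasure]
    [IsProbabilityMeasure μ] {F : Matrix (Fin n) (Fin n) ℂ → ℂ} (hF : Continuous F)
    (hFa : ∀ γ, CurveAnalytic γ → ∀ t, AnalyticAt ℝ (fun s => F (γ s)) t)
    (W : Matrix.unitaryGroup (Fin n) ℂ) (hW : F W ≠ 0) :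
    μ {U | F U = 0} = 0 := by
  have : SecondCountableTopology (Matrix (Fin n) (Fin n) ℂ) :=
    inferInstanceAs (SecondCountableTopology (Fin n → Fin n → ℂ))
  set s : Set ((Fin n → Fin n → ℂ) × Matrix.unitaryGroup (Fin n) ℂ) :=
    {p | F (cayleyUnitary p.1 * p.2 : Matrix.unitaryGroup (Fin n) ℂ) = 0}
  have hcont : Continuous fun p : (Fin n → Fin n → ℂ) × Matrix.unitaryGroup (Fin n) ℂ =>
      F (cayleyUnitary p.1 * p.2 : Matrix.unitaryGroup (Fin n) ℂ) :=
    hF.comp <| continuous_subtype_val.comp <|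
      (continuous_cayleyUnitary.comp continuous_fst).mul continuous_snd
  have hs : MeasurableSet s := (isClosed_singleton.preimage hcont).measurableSet
  have h0 : ((Measure.addHaar : Measure (Fin n → Fin n → ℂ)).prod μ) s = 0 := by
    rw [Measure.prod_apply_symm hs]
    refine (lintegral_congr fun U => ?_).trans lintegral_zero
    obtain ⟨W', hW', hunit⟩ := exists_ne_zero_and_isUnit_mul_inv_add_one U W hF hW
    obtain ⟨A, hA⟩ := exists_cayleyUnitary_eq _ hunit
    refine addHaar_eq_zero_of_forall_line _ (measurable_prodMk_right hs) A fun v => ?_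
    refine volume_zeros_eq_zero_of_analyticAt (t₀ := 0) (f := fun t : ℝ =>
      F (cayleyUnitary (A + t • v) * U : Matrix.unitaryGroup (Fin n) ℂ)) (fun t => ?_) ?_
    · exact hFa _ ((curveAnalytic_cayleyUnitary_line A v).mul (CurveAnalytic.const _)) t
    · simpa [hA] using hW'
  rw [Measure.prod_apply hs] at h0
  have h1 : ∀ A : Fin n → Fin n → ℂ, μ (Prod.mk A ⁻¹' s) = μ {U | F U = 0} := fun A =>
    measure_preimage_mul μ (cayleyUnitary A) {U | F U = 0}
  simp only [h1, lintegral_const, mul_eq_zero] at h0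
  exact h0.resolve_right (NeZero.ne _)

end Unitary

/-! ### Simplicity of the spectrum -/

section Krylov

variable {n : ℕ}

/-- The matrix whose `i`-th row is `(1, …, 1) Mⁱ`. -/
def krylov (M : Matrix (Fin n) (Fin n) ℂ) : Matrix (Fin n) (Fin n) ℂ :=
  Matrix.of fun i => 1 ᵥ* M ^ (i : ℕ)

theorem krylov_apply (M : Matrix (Fin n) (Fin n) ℂ) (i j : Fin n) :
    krylov M i j = ∑ k, (M ^ (i : ℕ)) k j := by
  simp [krylov, Matrix.vecMul, dotProduct]

theorem finrank_eigenspace_le_one_of_det_krylov_ne_zero {M : Matrix (Fin n) (Fin n) ℂ}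
    (h : (krylov M).det ≠ 0) (c : ℂ) :
    Module.finrank ℂ (Module.End.eigenspace M.mulVecLin c) ≤ 1 := by
  let φ : (Fin n → ℂ) →ₗ[ℂ] ℂ := ∑ k, LinearMap.proj k
  have hpow : ∀ v ∈ Module.End.eigenspace M.mulVecLin c, ∀ k : ℕ, (M ^ k) *ᵥ v = c ^ k • v := by
    intro v hv k
    have hv' : M *ᵥ v = c • v := Module.End.mem_eigenspace_iff.mp hv
    induction k with
    | zero => simp
    | succ k ih =>
      rw [pow_succ, ← Matrix.mulVec_mulVec, hv', Matrix.mulVec_smul, ih, smul_smul, pow_succ']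
  have hinj : Function.Injective (φ.domRestrict (Module.End.eigenspace M.mulVecLin c)) := by
    rw [← LinearMap.ker_eq_bot, LinearMap.ker_eq_bot']
    rintro ⟨v, hv⟩ hφ
    have hφ' : (1 : Fin n → ℂ) ⬝ᵥ v = 0 := by
      simpa [φ, dotProduct] using hφ
    have hK : krylov M *ᵥ v = 0 := by
      funext i
      change (1 ᵥ* M ^ (i : ℕ)) ⬝ᵥ v = 0
      rw [← Matrix.dotProduct_mulVec, hpow v hv, dotProduct_smul, hφ', smul_zero]
    exact Subtype.ext (Matrix.eq_zero_of_mulVec_eq_zero h hK)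
  simpa using LinearMap.finrank_le_finrank_of_injective hinj

theorem det_krylov_smul (a : ℂ) (M : Matrix (Fin n) (Fin n) ℂ) :
    (krylov (a • M)).det = (∏ i : Fin n, a ^ (i : ℕ)) * (krylov M).det := by
  rw [← Matrix.det_mul_column]
  congr 1
  ext i j
  simp [krylov_apply, smul_pow, Finset.mul_sum]

theorem det_krylov_diagonal_ne_zero {d : Fin n → ℂ} (hd : Function.Injective d) :
    (krylov (Matrix.diagonal d)).det ≠ 0 := by
  have : krylov (Matrix.diagonal d) = (Matrix.vandermonde d)ᵀ := by
    ext i j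
    simp [krylov_apply, Matrix.diagonal_pow, Matrix.diagonal_apply, Matrix.vandermonde_apply]
  rw [this, Matrix.det_transpose]
  exact Matrix.det_vandermonde_ne_zero_iff.mpr hd

theorem CurveAnalytic.krylov {γ : ℝ → Matrix (Fin n) (Fin n) ℂ} (hγ : CurveAnalytic γ) :
    CurveAnalytic fun t => krylov (γ t) := by
  intro i j t
  simp only [krylov_apply]
  exact Finset.analyticAt_fun_sum _ fun k _ => hγ.pow i k j t

theorem continuous_krylov : Continuous (krylov (n := n)) := by
  refine continuous_matrix fun i j => ?_
  simp only [krylov_apply]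
  exact continuous_finsetSum _ fun k _ => (continuous_pow (i : ℕ)).matrix_elem k j

end Krylov

/-! ### The numerator of the Cayley transform -/

section Numerator

variable {n : ℕ}

/-- The polynomial matrix `(U - 1) adj(U + 1)`, proportional to `HofU U`. -/
def cayleyNumerator (U : Matrix (Fin n) (Fin n) ℂ) : Matrix (Fin n) (Fin n) ℂ :=
  (U - 1) * (U + 1).adjugate

theorem HofU_eq_smul_cayleyNumerator (U : Matrix.unitaryGroup (Fin n) ℂ) :
    HofU U = (-2 * Complex.I * ((U : Matrix (Fin n) (Fin n) ℂ) + 1).det⁻¹) •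
      cayleyNumerator (U : Matrix (Fin n) (Fin n) ℂ) := by
  rw [HofU, cayleyNumerator, Matrix.inv_def, Ring.inverse_eq_inv', Matrix.mul_smul, smul_smul]

theorem continuous_cayleyNumerator : Continuous (cayleyNumerator (n := n)) :=
  (continuous_id.sub continuous_const).mul (continuous_id.add continuous_const).matrix_adjugate

theorem CurveAnalytic.cayleyNumerator {γ : ℝ → Matrix (Fin n) (Fin n) ℂ}
    (hγ : CurveAnalytic γ) : CurveAnalytic fun t => cayleyNumerator (γ t) :=
  (hγ.sub (CurveAnalytic.const 1)).mul (hγ.add (CurveAnalytic.const 1)).adjugate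

/-- Every Hermitian matrix is, up to a nonzero scalar, the numerator of a unitary matrix. -/
theorem exists_cayleyNumerator_eq_smul {X : Matrix (Fin n) (Fin n) ℂ} (hX : X.IsHermitian) :
    ∃ (W : Matrix.unitaryGroup (Fin n) ℂ) (a : ℂ), a ≠ 0 ∧
      cayleyNumerator (W : Matrix (Fin n) (Fin n) ℂ) = a • X := by
  have hd : (cayley X + 1).det ≠ 0 :=
    ((Matrix.isUnit_iff_isUnit_det _).mp (isUnit_cayley_add_one hX)).ne_zero
  refine ⟨⟨cayley X, cayley_mem_unitaryGroup hX⟩, (cayley X + 1).det * Complex.I,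
    mul_ne_zero hd Complex.I_ne_zero, ?_⟩
  rw [mul_smul, ← cayley_sub_one_mul_inv hX, Matrix.inv_def, Ring.inverse_eq_inv',
    Matrix.mul_smul, smul_smul, mul_inv_cancel₀ hd, one_smul, cayleyNumerator]

end Numerator

theorem stmt17 (n : ℕ) (hn : 1 ≤ n)
    (μ : Measure (Matrix.unitaryGroup (Fin n) ℂ)) (hμ : μ.IsHaarMeasure)
    (hprob : IsProbabilityMeasure μ) :
    μ {U : Matrix.unitaryGroup (Fin n) ℂ |
      ¬ (IsUnit ((U : Matrix (Fin n) (Fin n) ℂ) + 1) ∧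
         (HofU U).IsHermitian ∧
         (∀ i j, HofU U i j ≠ 0) ∧
         (∀ c : ℂ,
           Module.finrank ℂ (Module.End.eigenspace (HofU U).mulVecLin c) ≤ 1))} = 0 := by
  have h1 : ∀ᵐ U : Matrix.unitaryGroup (Fin n) ℂ ∂μ, ((U : Matrix (Fin n) (Fin n) ℂ) + 1).det ≠ 0 := by
    rw [ae_iff]
    simp only [ne_eq, not_not]
    refine haar_zeros_eq_zero μ (F := fun U => (U + 1).det)
      (continuous_id.add continuous_const).matrix_det
      (fun γ hγ => (hγ.add (CurveAnalytic.const 1)).det) 1 ?_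
    have h := isUnit_cayley_add_one (Matrix.isHermitian_zero (n := Fin n) (α := ℂ))
    simpa [cayley, Matrix.isUnit_iff_isUnit_det] using h
  have h2 : ∀ᵐ U : Matrix.unitaryGroup (Fin n) ℂ ∂μ, ∀ i j, cayleyNumerator (U : Matrix (Fin n) (Fin n) ℂ) i j ≠ 0 := by
    rw [ae_all_iff]
    intro i
    rw [ae_all_iff]
    intro j
    rw [ae_iff]
    simp only [ne_eq, not_not]
    have hX : (Matrix.of fun _ _ => 1 : Matrix (Fin n) (Fin n) ℂ).IsHermitian := by
      ext
      simp
    obtain ⟨W, a, ha, hW⟩ := exists_cayleyNumerator_eq_smul hX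
    refine haar_zeros_eq_zero μ (F := fun U => cayleyNumerator U i j)
      (continuous_cayleyNumerator.matrix_elem i j) (fun γ hγ => hγ.cayleyNumerator i j) W ?_
    simpa [hW] using ha
  have h3 : ∀ᵐ U : Matrix.unitaryGroup (Fin n) ℂ ∂μ, (krylov (cayleyNumerator (U : Matrix (Fin n) (Fin n) ℂ))).det ≠ 0 := by
    rw [ae_iff]
    simp only [ne_eq, not_not]
    have hX : (Matrix.diagonal fun i : Fin n => ((i : ℕ) : ℂ)).IsHermitian := by
      rw [Matrix.isHermitian_diagonal_iff]
      intro i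
      simp [IsSelfAdjoint]
    obtain ⟨W, a, ha, hW⟩ := exists_cayleyNumerator_eq_smul hX
    refine haar_zeros_eq_zero μ (F := fun U => (krylov (cayleyNumerator U)).det)
      (continuous_krylov.comp continuous_cayleyNumerator).matrix_det
      (fun γ hγ => hγ.cayleyNumerator.krylov.det) W ?_
    rw [hW, det_krylov_smul]
    refine mul_ne_zero (Finset.prod_ne_zero_iff.mpr fun i _ => pow_ne_zero _ ha)
      (det_krylov_diagonal_ne_zero fun i j hij => ?_)
    exact Fin.ext (by exact_mod_cast hij)
  rw [← ae_iff]
  filter_upwards [h1, h2, h3] with U hU1 hU2 hU3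
  have hunit : IsUnit ((U : Matrix (Fin n) (Fin n) ℂ) + 1) := by
    rw [Matrix.isUnit_iff_isUnit_det]
    exact hU1.isUnit
  have ha : -2 * Complex.I * ((U : Matrix (Fin n) (Fin n) ℂ) + 1).det⁻¹ ≠ 0 :=
    mul_ne_zero (by simp) (inv_ne_zero hU1)
  refine ⟨hunit, isHermitian_HofU U hunit, fun i j => ?_, fun c => ?_⟩
  · rw [HofU_eq_smul_cayleyNumerator]
    exact mul_ne_zero ha (hU2 i j)
  · apply finrank_eigenspace_le_one_of_det_krylov_ne_zero
    rw [HofU_eq_smul_cayleyNumerator, det_krylov_smul]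
    exact mul_ne_zero (Finset.prod_ne_zero_iff.mpr fun i _ => pow_ne_zero _ ha) hU3
end
end

section
/- Let M ⊆ ℂⁿ ⊕ ℂⁿ be a maximal isotropic subspace for the Hermitian symplectic form ω, and let L, L′ ⊆ ℂⁿ be linear subspaces. If M ∩ (L ⊕ L) is a maximal isotropic subspace of L ⊕ L (with respect to the restriction of ω) and M ∩ (L′ ⊕ L′) is a maximal isotropic subspace of L′ ⊕ L′, then M ∩ ((L ∩ L′) ⊕ (L ∩ L′)) is a maximal isotropic subspace of (L ∩ L′) ⊕ (L ∩ L′). -/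
noncomputable section

open scoped ComplexInnerProductSpace

abbrev H2 (n : ℕ) := EuclideanSpace ℂ (Fin n ⊕ Fin n)

/-- The canonical symplectic matrix `J(χ₁, χ₂) = (χ₂, −χ₁)` as a linear map on `ℂ^{2n}`. -/
def Jmap (n : ℕ) : H2 n →ₗ[ℂ] H2 n :=
  Matrix.toEuclideanLin (Matrix.fromBlocks 0 1 (-1) 0)

/-- The Hermitian symplectic form `ω(φ, ψ) = ⟨φ, J ψ⟩`. -/
def omegaForm (n : ℕ) (φ ψ : H2 n) : ℂ := ⟪φ, Jmap n ψ⟫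

/-- A subspace is isotropic if `ω` vanishes identically on it. -/
def IsIsotropic (n : ℕ) (M : Submodule ℂ (H2 n)) : Prop :=
  ∀ φ ∈ M, ∀ ψ ∈ M, omegaForm n φ ψ = 0

/-- A subspace is maximal isotropic if it is isotropic and not a proper subspace of a
larger isotropic subspace. -/
def IsMaxIsotropic (n : ℕ) (M : Submodule ℂ (H2 n)) : Prop :=
  IsIsotropic n M ∧
    ∀ M' : Submodule ℂ (H2 n), IsIsotropic n M' → M ≤ M' → M' = M

/-- Projection onto the first `ℂⁿ` component of `ℂⁿ ⊕ ℂⁿ`. -/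
def projL (n : ℕ) : H2 n →ₗ[ℂ] EuclideanSpace ℂ (Fin n) :=
  (WithLp.linearEquiv 2 ℂ ((Fin n) → ℂ)).symm.toLinearMap ∘ₗ
    (LinearMap.funLeft ℂ ℂ (Sum.inl : Fin n → Fin n ⊕ Fin n)) ∘ₗ
    (WithLp.linearEquiv 2 ℂ ((Fin n ⊕ Fin n) → ℂ)).toLinearMap

/-- Projection onto the second `ℂⁿ` component of `ℂⁿ ⊕ ℂⁿ`. -/
def projR (n : ℕ) : H2 n →ₗ[ℂ] EuclideanSpace ℂ (Fin n) :=
  (WithLp.linearEquiv 2 ℂ ((Fin n) → ℂ)).symm.toLinearMap ∘ₗ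
    (LinearMap.funLeft ℂ ℂ (Sum.inr : Fin n → Fin n ⊕ Fin n)) ∘ₗ
    (WithLp.linearEquiv 2 ℂ ((Fin n ⊕ Fin n) → ℂ)).toLinearMap

/-- For a subspace `L ⊆ ℂⁿ`, the subspace `L ⊕ L ⊆ ℂⁿ ⊕ ℂⁿ`. -/
def doubled (n : ℕ) (L : Submodule ℂ (EuclideanSpace ℂ (Fin n))) : Submodule ℂ (H2 n) :=
  L.comap (projL n) ⊓ L.comap (projR n)

/-- `N` is a maximal isotropic subspace of `L ⊕ L`: it lies in `L ⊕ L`, is isotropic for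
(the restriction of) `ω`, and has complex dimension `dim L`. -/
def IsMaxIsotropicIn (n : ℕ) (L : Submodule ℂ (EuclideanSpace ℂ (Fin n)))
    (N : Submodule ℂ (H2 n)) : Prop :=
  N ≤ doubled n L ∧ IsIsotropic n N ∧ Module.finrank ℂ N = Module.finrank ℂ L

theorem Jmap_inl {n : ℕ} (φ : H2 n) (i : Fin n) : Jmap n φ (Sum.inl i) = φ (Sum.inr i) := by
  simp [Jmap, Matrix.toLpLin_apply, Matrix.fromBlocks_mulVec]

theorem Jmap_inr {n : ℕ} (φ : H2 n) (i : Fin n) : Jmap n φ (Sum.inr i) = -φ (Sum.inl i) := by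
  simp [Jmap, Matrix.toLpLin_apply, Matrix.fromBlocks_mulVec, Matrix.neg_mulVec]

theorem projL_Jmap {n : ℕ} (φ : H2 n) : projL n (Jmap n φ) = projR n φ := by
  ext i
  exact Jmap_inl φ i

theorem projR_Jmap {n : ℕ} (φ : H2 n) : projR n (Jmap n φ) = -projL n φ := by
  ext i
  exact Jmap_inr φ i

theorem projL_projR_ext {n : ℕ} {φ ψ : H2 n} (hL : projL n φ = projL n ψ)
    (hR : projR n φ = projR n ψ) : φ = ψ := by
  ext (i | i)
  · exact congrArg (fun v : EuclideanSpace ℂ (Fin n) => v i) hL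
  · exact congrArg (fun v : EuclideanSpace ℂ (Fin n) => v i) hR

theorem Jmap_injective (n : ℕ) : Function.Injective (Jmap n) := by
  intro φ ψ h
  apply projL_projR_ext
  · simpa [projR_Jmap] using congrArg (projR n) h
  · simpa [projL_Jmap] using congrArg (projL n) h

theorem doubled_mono {n : ℕ} {L L' : Submodule ℂ (EuclideanSpace ℂ (Fin n))} (h : L ≤ L') :
    doubled n L ≤ doubled n L' :=
  inf_le_inf (Submodule.comap_mono h) (Submodule.comap_mono h)

theorem doubled_inf (n : ℕ) (L L' : Submodule ℂ (EuclideanSpace ℂ (Fin n))) :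
    doubled n (L ⊓ L') = doubled n L ⊓ doubled n L' := by
  simp only [doubled, Submodule.comap_inf]
  exact inf_inf_inf_comm _ _ _ _

theorem map_Jmap_doubled_le (n : ℕ) (L : Submodule ℂ (EuclideanSpace ℂ (Fin n))) :
    (doubled n L).map (Jmap n) ≤ doubled n L := by
  rintro _ ⟨φ, ⟨hL, hR⟩, rfl⟩
  refine ⟨?_, ?_⟩
  · simpa [projL_Jmap] using hR
  · simpa [projR_Jmap] using hL

theorem finrank_doubled_le (n : ℕ) (L : Submodule ℂ (EuclideanSpace ℂ (Fin n))) :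
    Module.finrank ℂ (doubled n L) ≤ Module.finrank ℂ L + Module.finrank ℂ L := by
  rw [← Module.finrank_prod (R := ℂ) (M := L) (M' := L)]
  refine LinearMap.finrank_le_finrank_of_injective
    (f := ((projL n).restrict (p := doubled n L) (q := L) fun _ h => h.1).prod
      ((projR n).restrict (p := doubled n L) (q := L) fun _ h => h.2)) ?_
  intro φ ψ h
  exact Subtype.ext <| projL_projR_ext (congrArg (fun p => (p.1 : EuclideanSpace ℂ (Fin n))) h)
    (congrArg (fun p => (p.2 : EuclideanSpace ℂ (Fin n))) h)

/-- An isotropic subspace `N` of `L ⊕ L` has dimension at most `dim L`, since `N` and `J N` are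
independent subspaces of `L ⊕ L`. -/
theorem IsIsotropic.finrank_le {n : ℕ} {L : Submodule ℂ (EuclideanSpace ℂ (Fin n))}
    {N : Submodule ℂ (H2 n)} (hN : IsIsotropic n N) (hNL : N ≤ doubled n L) :
    Module.finrank ℂ N ≤ Module.finrank ℂ L := by
  have hdisj : N ⊓ N.map (Jmap n) = ⊥ := by
    rw [eq_bot_iff]
    rintro _ ⟨hx, y, hy, rfl⟩
    exact inner_self_eq_zero.mp (hN _ hx y hy)
  have hJ : Module.finrank ℂ (N.map (Jmap n)) = Module.finrank ℂ N :=
    (Submodule.equivMapOfInjective _ (Jmap_injective n) N).finrank_eq.symm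
  have hsum := Submodule.finrank_sup_add_finrank_inf_eq N (N.map (Jmap n))
  have hle : N ⊔ N.map (Jmap n) ≤ doubled n L :=
    sup_le hNL ((Submodule.map_mono hNL).trans (map_Jmap_doubled_le n L))
  have hmono := Submodule.finrank_mono hle
  have hdoubled := finrank_doubled_le n L
  rw [hdisj, finrank_bot] at hsum
  omega

theorem IsIsotropic.mono {n : ℕ} {M N : Submodule ℂ (H2 n)} (hM : IsIsotropic n M) (h : N ≤ M) :
    IsIsotropic n N :=
  fun φ hφ ψ hψ => hM φ (h hφ) ψ (h hψ)

theorem stmt18 (n : ℕ) (M : Submodule ℂ (H2 n)) (hM : IsMaxIsotropic n M)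
    (L L' : Submodule ℂ (EuclideanSpace ℂ (Fin n)))
    (h1 : IsMaxIsotropicIn n L (M ⊓ doubled n L))
    (h2 : IsMaxIsotropicIn n L' (M ⊓ doubled n L')) :
    IsMaxIsotropicIn n (L ⊓ L') (M ⊓ doubled n (L ⊓ L')) := by
  have hK : IsIsotropic n (M ⊓ doubled n (L ⊓ L')) := hM.1.mono inf_le_left
  refine ⟨inf_le_right, hK, le_antisymm (hK.finrank_le inf_le_right) ?_⟩
  have hinf : (M ⊓ doubled n L) ⊓ (M ⊓ doubled n L') = M ⊓ doubled n (L ⊓ L') := by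
    rw [doubled_inf, ← inf_inf_distrib_left]
  have hsup : (M ⊓ doubled n L) ⊔ (M ⊓ doubled n L') ≤ M ⊓ doubled n (L ⊔ L') :=
    sup_le (inf_le_inf_left M (doubled_mono le_sup_left))
      (inf_le_inf_left M (doubled_mono le_sup_right))
  have hbound := (hM.1.mono (hsup.trans inf_le_left)).finrank_le (hsup.trans inf_le_right)
  have hdim := Submodule.finrank_sup_add_finrank_inf_eq (M ⊓ doubled n L) (M ⊓ doubled n L')
  have hdimL := Submodule.finrank_sup_add_finrank_inf_eq L L'
  rw [hinf, h1.2.2, h2.2.2] at hdim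
  omega
end
end
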